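/- Let G = (V, E) be a finite connected undirected simple graph, and let Ĝ = (V, Ê) be the graph on the same vertex set in which {u, v} ∈ Ê if and only if u ≠ v and the shortest path between u and v in G is maximal. Then the strong metric dimension of G equals the minimum size of a vertex cover of Ĝ, i.e., sdim(G) = MNC(Ĝ). -/

import Mathlib

/-- Node `x` strongly resolves the pair `{u, v}`: `v` lies on some shortest path between
`x` and `u`, or `u` lies on some shortest path between `x` and `v` (expressed via
distances in a connected graph). -/
def StronglyResolves {V : Type*} (G : SimpleGraph V) (x u v : V) : Prop :=
  G.dist x v + G.dist v u = G.dist x u ∨ G.dist x u + G.dist u v = G.dist x v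

/-- `S` is a strongly resolving set for `G`. -/
def IsStronglyResolvingSet {V : Type*} (G : SimpleGraph V) (S : Set V) : Prop :=
  ∀ u v : V, u ≠ v → ∃ x ∈ S, StronglyResolves G x u v

/-- The shortest path between `u` and `v` is maximal. -/
def MaximalShortestPathPair {V : Type*} (G : SimpleGraph V) (u v : V) : Prop :=
  (∀ x : V, G.Adj u x → G.dist x v ≤ G.dist u v) ∧
  (∀ y : V, G.Adj v y → G.dist y u ≤ G.dist u v)

/-- The graph `Ĝ`: `{u,v}` is an edge iff `u ≠ v` and the shortest path between `u` and
`v` in `G` is maximal. -/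
def hatGraph {V : Type*} (G : SimpleGraph V) : SimpleGraph V :=
  SimpleGraph.fromRel (MaximalShortestPathPair G)

/-- `C` is a vertex cover of `G`. -/
def IsVertexCover {V : Type*} (G : SimpleGraph V) (C : Set V) : Prop :=
  ∀ u v : V, G.Adj u v → u ∈ C ∨ v ∈ C

/-- The strong metric dimension: minimum size of a strongly resolving set. -/
noncomputable def sdim {V : Type*} (G : SimpleGraph V) : ℕ :=
  sInf {k | ∃ S : Set V, IsStronglyResolvingSet G S ∧ S.ncard = k}

/-- The minimum size of a vertex cover. -/
noncomputable def MNC {V : Type*} (G : SimpleGraph V) : ℕ :=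
  sInf {k | ∃ C : Set V, IsVertexCover G C ∧ C.ncard = k}

/-- A vertex other than `x` has a neighbor strictly closer to `x`. -/
theorem SimpleGraph.Connected.exists_adj_dist_add_one_eq {V : Type*} {G : SimpleGraph V}
    (hG : G.Connected) {v x : V} (hvx : v ≠ x) :
    ∃ y, G.Adj v y ∧ G.dist y x + 1 = G.dist v x := by
  obtain ⟨p, hp⟩ := hG.exists_walk_length_eq_dist v x
  cases p with
  | nil => exact absurd rfl hvx
  | @cons _ y _ h q =>
    refine ⟨y, h, ?_⟩
    have hvy := SimpleGraph.dist_eq_one_iff_adj.mpr h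
    have hq := SimpleGraph.dist_le q
    have htri := hG.dist_triangle (u := v) (v := y) (w := x)
    rw [SimpleGraph.Walk.length_cons] at hp
    omega

theorem MaximalShortestPathPair.symm {V : Type*} {G : SimpleGraph V} {u v : V}
    (h : MaximalShortestPathPair G u v) : MaximalShortestPathPair G v u := by
  unfold MaximalShortestPathPair at *
  rw [G.dist_comm (u := v)]
  exact h.symm

theorem hatGraph_adj {V : Type*} {G : SimpleGraph V} {u v : V} :
    (hatGraph G).Adj u v ↔ u ≠ v ∧ MaximalShortestPathPair G u v := by
  rw [hatGraph, SimpleGraph.fromRel_adj]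
  exact and_congr_right fun _ => ⟨fun h => h.elim id .symm, .inl⟩

/-- If no neighbor of `v` is farther from `u` than `v` is, then no shortest path from `u`
extends beyond `v`. -/
theorem SimpleGraph.Connected.eq_of_dist_add_dist_eq {V : Type*} {G : SimpleGraph V}
    (hG : G.Connected) {u v x : V} (hv : ∀ y, G.Adj v y → G.dist y u ≤ G.dist u v)
    (hx : G.dist x v + G.dist v u = G.dist x u) : x = v := by
  by_contra hne
  obtain ⟨y, hvy, hy⟩ := hG.exists_adj_dist_add_one_eq (Ne.symm hne)
  have hyu := hv y hvy
  have htri := hG.dist_triangle (u := x) (v := y) (w := u)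
  rw [G.dist_comm (u := y) (v := x), G.dist_comm (u := v) (v := x)] at hy
  rw [G.dist_comm (u := u)] at hyu
  omega

/-- In a finite connected graph, every shortest path extends to a maximal one. -/
theorem SimpleGraph.Connected.exists_maximalShortestPathPair {V : Type*} [Finite V]
    {G : SimpleGraph V} (hG : G.Connected) (u v : V) :
    ∃ a b, MaximalShortestPathPair G a b ∧
      G.dist a u + G.dist u v + G.dist v b = G.dist a b := by
  obtain ⟨⟨a, b⟩, hab, hmax⟩ := Set.exists_max_image
    {p : V × V | G.dist p.1 u + G.dist u v + G.dist v p.2 = G.dist p.1 p.2}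
    (fun p => G.dist p.1 p.2) (Set.toFinite _) ⟨(u, v), by simp⟩
  simp only [Set.mem_ofPred_eq, Prod.forall] at hab hmax
  refine ⟨a, b, ⟨fun x hx => ?_, fun y hy => ?_⟩, hab⟩
  · by_contra! hlt
    have hxa := SimpleGraph.dist_eq_one_iff_adj.mpr hx.symm
    have hxu := hG.dist_triangle (u := x) (v := a) (w := u)
    have hxv := hG.dist_triangle (u := x) (v := u) (w := v)
    have hxb := hG.dist_triangle (u := x) (v := v) (w := b)
    have := hmax x b (by omega)
    omega
  · by_contra! hlt
    rw [G.dist_comm (u := y)] at hlt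
    have hby := SimpleGraph.dist_eq_one_iff_adj.mpr hy
    have hvy := hG.dist_triangle (u := v) (v := b) (w := y)
    have huy := hG.dist_triangle (u := u) (v := v) (w := y)
    have hay := hG.dist_triangle (u := a) (v := u) (w := y)
    have := hmax a y (by omega)
    omega

/-- Strongly resolving sets of `G` are exactly the vertex covers of `Ĝ`. -/
theorem isStronglyResolvingSet_iff_isVertexCover_hatGraph {V : Type*} [Finite V]
    {G : SimpleGraph V} (hG : G.Connected) (S : Set V) :
    IsStronglyResolvingSet G S ↔ IsVertexCover (hatGraph G) S := by
  constructor
  · intro hS u v huv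
    obtain ⟨hne, hmax⟩ := hatGraph_adj.mp huv
    obtain ⟨x, hxS, hx | hx⟩ := hS u v hne
    · exact .inr (hG.eq_of_dist_add_dist_eq hmax.2 hx ▸ hxS)
    · exact .inl (hG.eq_of_dist_add_dist_eq hmax.symm.2 hx ▸ hxS)
  · intro hC u v hne
    obtain ⟨a, b, hmax, hab⟩ := hG.exists_maximalShortestPathPair u v
    have huv := hG.pos_dist_of_ne hne
    have hab_ne : a ≠ b := by
      rintro rfl
      rw [SimpleGraph.dist_self] at hab
      omega
    have hauv := hG.dist_triangle (u := a) (v := u) (w := v)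
    have havb := hG.dist_triangle (u := a) (v := v) (w := b)
    have huvb := hG.dist_triangle (u := u) (v := v) (w := b)
    have haub := hG.dist_triangle (u := a) (v := u) (w := b)
    rcases hC a b (hatGraph_adj.mpr ⟨hab_ne, hmax⟩) with ha | hb
    · exact ⟨a, ha, .inr (by omega)⟩
    · refine ⟨b, hb, .inl ?_⟩
      rw [G.dist_comm (u := b) (v := v), G.dist_comm (u := v) (v := u),
        G.dist_comm (u := b) (v := u)]
      omega

theorem sdim_eq_mnc_hatGraph {V : Type*} [Fintype V] (G : SimpleGraph V)
    (hG : G.Connected) : sdim G = MNC (hatGraph G) := by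
  simp only [sdim, MNC, isStronglyResolvingSet_iff_isVertexCover_hatGraph hG]
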